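/- Let (Σ) be a DAE system defined by f_1,…,f_r ∈ K{X_1,…,X_n} and 𝔓 a minimal prime differential ideal containing f_1,…,f_r such that (Σ) is quasi-regular at 𝔓 and the standing rank hypothesis holds. Let 𝓔₀ = (ε_{ij}) be the r×n matrix with ε_{ij} = ord_{X_j}(f_i) and ε_{ij} = 0 if X_j does not appear in f_i. Then the 𝔓-differentiation index σ and the order ord(𝔓) satisfy σ + ord(𝔓) ≤ J(𝓔₀) + max{ε_{ij}} − min{ε_{ij}}. -/

import Mathlib

set_option synthInstance.maxHeartbeats 1000000
set_option maxHeartbeats 4000000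

noncomputable section

namespace DAE

open MvPolynomial

/-- The ring of differential polynomials `K{X_1,…,X_n}`: the polynomial ring in the
variables `X_j^{(l)}`, `1 ≤ j ≤ n`, `l ∈ ℕ`. -/
abbrev DP (K : Type) [Field K] (n : ℕ) : Type := MvPolynomial (Fin n × ℕ) K

variable {K : Type} [Field K] {n : ℕ}

/-- `δ : K → K` is a derivation of the field `K`. -/
structure IsDeriv (K : Type) [Field K] (δ : K → K) : Prop where
  map_add : ∀ a b, δ (a + b) = δ a + δ b
  leibniz : ∀ a b, δ (a * b) = a * δ b + b * δ a

/-- `D` is the total derivation of `K{X}` extending the derivation `δ` of `K`, with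
`D X_j^{(l)} = X_j^{(l+1)}`. The `p`-th total derivative of `g` is `D^[p] g`. -/
structure IsTotalDeriv (K : Type) [Field K] (n : ℕ) (δ : K → K) (D : DP K n → DP K n) : Prop where
  map_add : ∀ f g, D (f + g) = D f + D g
  leibniz : ∀ f g, D (f * g) = f * D g + g * D f
  map_C : ∀ a : K, D (C a) = C (δ a)
  map_X : ∀ (j : Fin n) (l : ℕ), D (X (j, l)) = X (j, l + 1)

/-- the maximal order of derivation of `X_j` appearing in `f` (`0` when absent) -/
def ordIn (f : DP K n) (j : Fin n) : ℕ :=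
  (f.vars.filter fun v => v.1 = j).sup fun v => v.2

/-- some derivative of `X_j` appears in `f` -/
def appearsIn (f : DP K n) (j : Fin n) : Prop :=
  (f.vars.filter fun v => v.1 = j).Nonempty

instance {K : Type} [Field K] {n : ℕ} (f : DP K n) (j : Fin n) : Decidable (appearsIn f j) := by
  unfold appearsIn; infer_instance

/-- the order of `f`: maximal order of derivation of a variable appearing in `f` -/
def ordOf (f : DP K n) : ℕ := f.vars.sup fun v => v.2

/-- `I` is a differential ideal (stable under the total derivation `D`) -/
def IsDiffIdeal (D : DP K n → DP K n) (I : Ideal (DP K n)) : Prop := ∀ g ∈ I, D g ∈ I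

/-- the differential ideal `[f_1,…,f_r]` generated by `f_1,…,f_r` -/
def diffIdealGen (D : DP K n → DP K n) {r : ℕ} (f : Fin r → DP K n) : Ideal (DP K n) :=
  sInf {I | (∀ t, f t ∈ I) ∧ IsDiffIdeal D I}

/-- `𝔓` is a prime differential ideal, minimal among those containing `f_1,…,f_r` -/
def IsMinimalPrimeDiff (D : DP K n → DP K n) {r : ℕ} (f : Fin r → DP K n)
    (𝔓 : Ideal (DP K n)) : Prop :=
  𝔓.IsPrime ∧ IsDiffIdeal D 𝔓 ∧ (∀ t, f t ∈ 𝔓) ∧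
    ∀ Q : Ideal (DP K n), Q.IsPrime → IsDiffIdeal D Q → (∀ t, f t ∈ Q) → Q ≤ 𝔓 → Q = 𝔓

/-- the polynomial ring `A_i := K[X^{[i]}]` -/
abbrev AP (K : Type) [Field K] (n i : ℕ) : Type := MvPolynomial (Fin n × Fin (i + 1)) K

/-- the inclusion `A_i ↪ K{X}` -/
def inclA (K : Type) [Field K] (n i : ℕ) : AP K n i →+* DP K n :=
  (rename fun v : Fin n × Fin (i + 1) => ((v.1, (v.2 : ℕ)) : Fin n × ℕ)).toRingHom

/-- the truncation `K{X} → A_i` (a retraction of `inclA`, exact on polynomials of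
order at most `i`) -/
def truncA (K : Type) [Field K] (n i : ℕ) : DP K n →+* AP K n i :=
  (aeval fun v : Fin n × ℕ =>
    if h : v.2 < i + 1 then (X (v.1, ⟨v.2, h⟩) : AP K n i) else 0).toRingHom

/-- the contraction `A_i ∩ 𝔓` -/
def Pc {K : Type} [Field K] {n : ℕ} (i : ℕ) (𝔓 : Ideal (DP K n)) : Ideal (AP K n i) :=
  𝔓.comap (inclA K n i)

instance {K : Type} [Field K] {n : ℕ} (i : ℕ) (𝔓 : Ideal (DP K n)) [𝔓.IsPrime] :
    (Pc i 𝔓).IsPrime := Ideal.IsPrime.comap _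

/-- the local ring `B_i`: the localization of `A_i` at the prime `A_i ∩ 𝔓` -/
abbrev BL (K : Type) [Field K] (n : ℕ) (i : ℕ) (𝔓 : Ideal (DP K n)) [𝔓.IsPrime] : Type :=
  Localization.AtPrime (Pc (K := K) (n := n) i 𝔓)

/-- the transition map `A_i → A_{i'}` for `i ≤ i'` -/
def renAA (K : Type) [Field K] (n : ℕ) {i i' : ℕ} (h : i ≤ i') : AP K n i →+* AP K n i' :=
  (rename (Prod.map (id : Fin n → Fin n) (Fin.castLE (by omega)))).toRingHom

lemma inclA_comp_renAA (K : Type) [Field K] (n : ℕ) {i i' : ℕ} (h : i ≤ i') :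
    (inclA K n i').comp (renAA K n h) = inclA K n i := by
  ext p
  · simp [inclA, renAA]
  · simp [inclA, renAA]

lemma Pc_eq_comap {K : Type} [Field K] {n : ℕ} (𝔓 : Ideal (DP K n)) {i i' : ℕ} (h : i ≤ i') :
    Pc i 𝔓 = (Pc i' 𝔓).comap (renAA K n h) := by
  unfold Pc
  rw [Ideal.comap_comap, inclA_comp_renAA]

/-- the canonical local map `B_i → B_{i'}`, `i ≤ i'` -/
def ringBB {K : Type} [Field K] {n : ℕ} (𝔓 : Ideal (DP K n)) [𝔓.IsPrime] {i i' : ℕ}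
    (h : i ≤ i') : BL K n i 𝔓 →+* BL K n i' 𝔓 :=
  Localization.localRingHom _ _ (renAA K n h) (Pc_eq_comap 𝔓 h)

/-- the canonical local map `B_i → K{X}_𝔓` -/
def ringBP {K : Type} [Field K] {n : ℕ} (𝔓 : Ideal (DP K n)) [𝔓.IsPrime] (i : ℕ) :
    BL K n i 𝔓 →+* Localization.AtPrime 𝔓 :=
  Localization.localRingHom _ _ (inclA K n i) rfl

/-- the image in `B_j` of a differential polynomial (of order `≤ j`) -/
def bElem {K : Type} [Field K] {n : ℕ} (𝔓 : Ideal (DP K n)) [𝔓.IsPrime] (j : ℕ)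
    (g : DP K n) : BL K n j 𝔓 :=
  algebraMap (AP K n j) (BL K n j 𝔓) (truncA K n j g)

/-- the prolongation ideal `Δ_m = (f_1^{[m-1]},…,f_r^{[m-1]})` in the ring `B_j` -/
def prolong (D : DP K n → DP K n) {r : ℕ} (f : Fin r → DP K n)
    (𝔓 : Ideal (DP K n)) [𝔓.IsPrime] (m j : ℕ) : Ideal (BL K n j 𝔓) :=
  Ideal.span {x | ∃ (t : Fin r) (s : ℕ) (a : AP K n j),
    s < m ∧ inclA K n j a = D^[s] (f t) ∧ x = algebraMap (AP K n j) (BL K n j 𝔓) a}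

/-- `Δ := 𝔓·K{X}_𝔓` -/
def bigDelta {K : Type} [Field K] {n : ℕ} (𝔓 : Ideal (DP K n)) [𝔓.IsPrime] :
    Ideal (Localization.AtPrime 𝔓) :=
  Ideal.map (algebraMap (DP K n) (Localization.AtPrime 𝔓)) 𝔓

instance {K : Type} [Field K] {n : ℕ} (𝔓 : Ideal (DP K n)) [𝔓.IsPrime] :
    IsDomain (DP K n ⧸ 𝔓) := Ideal.Quotient.isDomain 𝔓

/-- `𝕂 := Frac(K{X}/𝔓)`, the residual field of `𝔓` -/
abbrev KK (K : Type) [Field K] (n : ℕ) (𝔓 : Ideal (DP K n)) [𝔓.IsPrime] : Type :=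
  FractionRing (DP K n ⧸ 𝔓)

/-- the canonical map `K{X} → 𝕂` -/
def toKK {K : Type} [Field K] {n : ℕ} (𝔓 : Ideal (DP K n)) [𝔓.IsPrime] :
    DP K n →+* KK K n 𝔓 :=
  (algebraMap (DP K n ⧸ 𝔓) (KK K n 𝔓)).comp (Ideal.Quotient.mk 𝔓)

/-- the Jacobian matrix of `f_1^{[i-1]},…,f_r^{[i-1]}` with respect to `X^{[i-1+e]}`,
with entries taken in `𝕂` (full row rank over the domain `A_{i-1+e}/(A_{i-1+e}∩𝔓)` is
equivalent to full rank over its fraction field, hence over `𝕂`). -/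
def qrJac (D : DP K n → DP K n) {r : ℕ} (f : Fin r → DP K n)
    (𝔓 : Ideal (DP K n)) [𝔓.IsPrime] (e i : ℕ) :
    Matrix (Fin r × Fin i) (Fin n × Fin (i + e)) (KK K n 𝔓) :=
  fun p q => toKK 𝔓 (pderiv (q.1, (q.2 : ℕ)) (D^[(p.2 : ℕ)] (f p.1)))

/-- the system `f_1,…,f_r` is quasi-regular at `𝔓` -/
def IsQuasiRegularAt (D : DP K n → DP K n) {r : ℕ} (f : Fin r → DP K n)
    (𝔓 : Ideal (DP K n)) [𝔓.IsPrime] (e : ℕ) : Prop :=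
  ∀ i : ℕ, 1 ≤ i → (qrJac D f 𝔓 e i).rank = r * i

/-- the entry of the pseudo-Jacobian `𝔍_{k,i}` in block `(p,q)`, row `t := p.2`,
column `j := q.2`: `∂ f_t^{(i-e+1+p)} / ∂ X_j^{(i+1+q)}` -/
def jEntry (D : DP K n → DP K n) {r : ℕ} (f : Fin r → DP K n) (e i : ℕ) {k : ℕ}
    (p : Fin k × Fin r) (q : Fin k × Fin n) : DP K n :=
  pderiv (q.2, i + 1 + (q.1 : ℕ)) (D^[i + 1 - e + (p.1 : ℕ)] (f p.2))

/-- the pseudo-Jacobian `𝔍_{k,i}` over `𝕂` -/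
def Jmat (D : DP K n → DP K n) {r : ℕ} (f : Fin r → DP K n)
    (𝔓 : Ideal (DP K n)) [𝔓.IsPrime] (e k i : ℕ) :
    Matrix (Fin k × Fin r) (Fin k × Fin n) (KK K n 𝔓) :=
  fun p q => toKK 𝔓 (jEntry D f e i p q)

/-- `μ_{k,i} := kr − rank_𝕂 𝔍_{k,i}` -/
def mu (D : DP K n → DP K n) {r : ℕ} (f : Fin r → DP K n)
    (𝔓 : Ideal (DP K n)) [𝔓.IsPrime] (e k i : ℕ) : ℕ :=
  k * r - (Jmat D f 𝔓 e k i).rank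

/-- the pseudo-Jacobian `𝔍_{k,i}` over the ring `B_j / Δ_m` -/
def JmatOver (D : DP K n → DP K n) {r : ℕ} (f : Fin r → DP K n)
    (𝔓 : Ideal (DP K n)) [𝔓.IsPrime] (e k i m j : ℕ) :
    Matrix (Fin k × Fin r) (Fin k × Fin n) (BL K n j 𝔓 ⧸ prolong D f 𝔓 m j) :=
  fun p q => Ideal.Quotient.mk _ (bElem 𝔓 j (jEntry D f e i p q))

/-- the standing rank hypothesis: for every `k,i` the rank of `𝔍_{k,i}` over the
domain `B_{i+k+s}/Δ_{i-1+e+k+s}` does not depend on `s` and equals its rank over `𝕂` -/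
def StandingRank (D : DP K n → DP K n) {r : ℕ} (f : Fin r → DP K n)
    (𝔓 : Ideal (DP K n)) [𝔓.IsPrime] (e : ℕ) : Prop :=
  ∀ k i s : ℕ, 1 ≤ k → e - 1 ≤ i →
    (JmatOver D f 𝔓 e k i (i - 1 + e + k + s) (i + k + s)).rank = (Jmat D f 𝔓 e k i).rank

/-- the Jacobi number of a matrix of natural numbers -/
def jacobiN {ι κ : Type} [Fintype ι] [Fintype κ] [DecidableEq ι] [DecidableEq κ]
    (M : ι → κ → ℕ) : ℕ :=
  Finset.univ.sup fun τ : {τ : ι → κ // Function.Injective τ} => ∑ i, M i (τ.1 i)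

/-- the Jacobi number of a matrix with entries in `ℕ₀ ∪ {−∞}` -/
def jacobiE {ι κ : Type} [Fintype ι] [Fintype κ] [DecidableEq ι] [DecidableEq κ]
    (M : ι → κ → WithBot ℕ) : WithBot ℕ :=
  Finset.univ.sup fun τ : {τ : ι → κ // Function.Injective τ} => ∑ i, M i (τ.1 i)

/-- the (finite) transcendence degree of `E` over `F` equals `d` -/
def HasTrdeg (F E : Type) [CommRing F] [CommRing E] [Algebra F E] (d : ℕ) : Prop :=
  ∃ s : Finset E, IsTranscendenceBasis F (fun x : {x : E // x ∈ s} => x.1) ∧ s.card = d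

end DAE


namespace DAE


lemma egervary_sq {n : ℕ} (M : Fin n → Fin n → ℕ) :
    ∃ (a b : Fin n → ℤ) (τ : Fin n → Fin n), Function.Injective τ ∧
      (∀ i j, (M i j : ℤ) ≤ a i + b j) ∧ ∑ i, a i + ∑ j, b j = ∑ i, (M i (τ i) : ℤ) := by
  classical
  let P : ℕ → Prop := fun v => ∃ a b : Fin n → ℤ, (∀ i j, (M i j : ℤ) ≤ a i + b j) ∧
    ∑ i, a i + ∑ j, b j = v
  have hne : ∃ v, P v := by
    refine ⟨∑ i, ∑ j, M i j, fun i => ∑ j, (M i j : ℤ), 0, ?_, by simp⟩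
    intro i j
    have := Finset.single_le_sum (f := fun j => (M i j : ℤ)) (fun _ _ => by positivity)
      (Finset.mem_univ j)
    simpa using this
  obtain ⟨a, b, hab, hs⟩ := Nat.find_spec hne
  have hmin : ∀ a' b' : Fin n → ℤ, (∀ i j, (M i j : ℤ) ≤ a' i + b' j) →
      ∑ i, a i + ∑ j, b j ≤ ∑ i, a' i + ∑ j, b' j := by
    intro a' b' h
    have h0 : 0 ≤ ∑ i, a' i + ∑ j, b' j := by
      rw [← Finset.sum_add_distrib]
      exact Finset.sum_nonneg fun i _ => le_trans (by positivity) (h i i)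
    have := Nat.find_min' hne (m := (∑ i, a' i + ∑ j, b' j).toNat)
      ⟨a', b', h, (Int.toNat_of_nonneg h0).symm⟩
    rw [hs]; omega
  have hall : ∀ I : Finset (Fin n),
      I.card ≤ (I.biUnion fun i => Finset.univ.filter fun j => a i + b j = M i j).card := by
    intro I
    set N := I.biUnion fun i => Finset.univ.filter fun j => a i + b j = M i j with hN
    have := hmin (fun i => a i - if i ∈ I then 1 else 0) (fun j => b j + if j ∈ N then 1 else 0) ?_
    · simp only [Finset.sum_sub_distrib, Finset.sum_add_distrib, Finset.sum_ite_mem,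
        Finset.univ_inter, Finset.sum_const, nsmul_eq_mul, mul_one] at this
      omega
    · intro i j
      have h1 := hab i j
      by_cases hi : i ∈ I
      · by_cases hj : j ∈ N
        · simp only [hi, hj, if_true]; omega
        · have : a i + b j ≠ M i j := fun h => hj (by
            rw [hN, Finset.mem_biUnion]; exact ⟨i, hi, by simpa using h⟩)
          simp only [hi, hj, if_true, if_false]; omega
      · simp only [hi, if_false]; split_ifs <;> omega
  obtain ⟨τ, hτ, hτ'⟩ := (Finset.all_card_le_biUnion_card_iff_exists_injective _).1 hall
  refine ⟨a, b, τ, hτ, hab, ?_⟩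
  have hb : ∑ j, b j = ∑ i, b (τ i) :=
    (Function.Bijective.sum_comp (Finite.injective_iff_bijective.1 hτ) b).symm
  rw [hb, ← Finset.sum_add_distrib]
  exact Finset.sum_congr rfl fun i _ => by simpa using hτ' i

lemma egervary {r n : ℕ} (hrn : r ≤ n) (hn : 0 < n) (M : Fin r → Fin n → ℕ) (m : ℕ)
    (hm : ∀ i j, m ≤ M i j) :
    ∃ (a : Fin r → ℕ) (b : Fin n → ℕ) (τ : Fin r → Fin n), Function.Injective τ ∧
      (∀ i, m ≤ a i) ∧ (∀ i j, M i j ≤ a i + b j) ∧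
      ∑ i, a i + ∑ j, b j ≤ ∑ i, M i (τ i) := by
  classical
  obtain ⟨a, b, τ, hτ, hab, hs⟩ := egervary_sq
    (fun i j : Fin n => if h : (i : ℕ) < r then M ⟨i, h⟩ j else 0)
  have : Nonempty (Fin n) := ⟨⟨0, hn⟩⟩
  obtain ⟨j0, hj0⟩ := Finite.exists_min b
  have ha0 : ∀ i, 0 ≤ a i + b j0 := fun i => le_trans (by positivity) (hab i j0)
  have ham : ∀ i : Fin r, (m : ℤ) ≤ a (Fin.castLE hrn i) + b j0 := fun i => by
    refine le_trans ?_ (hab _ j0)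
    simpa using hm i j0
  have hsplit : ∀ g : Fin n → ℤ, (∀ i, 0 ≤ g i) → ∑ i : Fin r, g (Fin.castLE hrn i) ≤ ∑ i, g i := by
    intro g hg
    have h1 := Finset.sum_map Finset.univ (Fin.castLEEmb hrn) g
    simp only [Fin.castLEEmb_apply] at h1
    rw [← h1]
    exact Finset.sum_le_sum_of_subset_of_nonneg (Finset.subset_univ _) fun i _ _ => hg i
  have hsplit' : ∑ i : Fin r, (M i (τ (Fin.castLE hrn i)) : ℤ) =
      ∑ i : Fin n, (((if h : (i : ℕ) < r then M ⟨i, h⟩ (τ i) else 0 : ℕ)) : ℤ) := by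
    rw [← Finset.sum_subset (Finset.subset_univ (Finset.univ.map (Fin.castLEEmb hrn)))]
    · rw [Finset.sum_map]
      simp
    · intro i _ hi
      have : ¬ (i : ℕ) < r := fun h => hi (by
        simp only [Finset.mem_map, Finset.mem_univ, true_and]
        exact ⟨⟨i, h⟩, by ext; simp⟩)
      simp [this]
  refine ⟨fun i => (a (Fin.castLE hrn i) + b j0).toNat, fun j => (b j - b j0).toNat,
    fun i => τ (Fin.castLE hrn i), hτ.comp (Fin.castLE_injective hrn), ?_, ?_, ?_⟩
  · intro i; have := ham i; dsimp only; omega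
  · intro i j
    have h1 := hab (Fin.castLE hrn i) j
    have h2 := hj0 j
    have h3 := ha0 (Fin.castLE hrn i)
    simp at h1
    dsimp only
    omega
  · zify
    rw [hsplit', ← hs]
    have h1 : ∀ i, ((a i + b j0).toNat : ℤ) = a i + b j0 := fun i => Int.toNat_of_nonneg (ha0 i)
    have h2 : ∀ j, ((b j - b j0).toNat : ℤ) = b j - b j0 := fun j =>
      Int.toNat_of_nonneg (by have := hj0 j; omega)
    simp only [h1, h2]
    have := hsplit (fun i => a i + b j0) ha0
    simp only [Finset.sum_add_distrib, Finset.sum_sub_distrib] at this ⊢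
    simp at this ⊢
    linarith

end DAE



section kaehler
namespace DAE
open KaehlerDifferential TensorProduct
open IntermediateField.algebraAdjoinAdjoin in

lemma linIndep_D_of_basis {K L ι : Type} [Field K] [Field L] [Algebra K L] [CharZero K]
    (x : ι → L) (hx : IsTranscendenceBasis K x) :
    LinearIndependent L (fun i => KaehlerDifferential.D K L (x i)) := by
  classical
  let : Algebra (MvPolynomial ι K) (Algebra.adjoin K (Set.range x)) :=
    hx.1.aevalEquiv.toRingEquiv.toRingHom.toAlgebra
  let : Algebra (MvPolynomial ι K) L := (MvPolynomial.aeval x).toRingHom.toAlgebra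
  have : IsScalarTower K (MvPolynomial ι K) L := IsScalarTower.of_algebraMap_eq (fun a => by
    simp [RingHom.algebraMap_toAlgebra])
  have : IsScalarTower (MvPolynomial ι K) (Algebra.adjoin K (Set.range x)) L :=
    IsScalarTower.of_algebraMap_eq (fun a => by
      change MvPolynomial.aeval x a = ((hx.1.aevalEquiv a : Algebra.adjoin K (Set.range x)) : L)
      simp)
  have : Algebra.FormallyEtale (MvPolynomial ι K) (Algebra.adjoin K (Set.range x)) :=
    Algebra.FormallyEtale.of_equiv
      (AlgEquiv.ofRingEquiv (f := hx.1.aevalEquiv.toRingEquiv) (fun a => rfl) :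
        MvPolynomial ι K ≃ₐ[MvPolynomial ι K] _)
  have : Algebra.FormallyEtale (Algebra.adjoin K (Set.range x))
      (IntermediateField.adjoin K (Set.range x)) :=
    .of_isLocalization (nonZeroDivisors _)
  have := hx.isAlgebraic_field
  have : CharZero (IntermediateField.adjoin K (Set.range x)) :=
    charZero_of_injective_algebraMap (algebraMap K _).injective
  have : Algebra.FormallyEtale (IntermediateField.adjoin K (Set.range x)) L :=
    Algebra.FormallyEtale.of_isSeparable _ L
  have : Algebra.FormallyEtale (Algebra.adjoin K (Set.range x)) L :=
    .comp _ (IntermediateField.adjoin K (Set.range x)) _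
  have : Algebra.FormallyEtale (MvPolynomial ι K) L :=
    .comp _ (Algebra.adjoin K (Set.range x)) _
  let b := ((mvPolynomialBasis K ι).baseChange L).map
    (tensorKaehlerEquivOfFormallyEtale K (MvPolynomial ι K) L)
  have : (fun i => KaehlerDifferential.D K L (x i)) = b := by
    funext i
    have : x i = algebraMap (MvPolynomial ι K) L (MvPolynomial.X i) := by
      change _ = MvPolynomial.aeval x _
      simp
    simp [b, this]
  rw [this]
  exact b.linearIndependent

lemma linIndep_D {K L : Type} [Field K] [Field L] [Algebra K L] [CharZero K]
    (s : Set L) (hx : AlgebraicIndepOn K id s) :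
    LinearIndependent L (fun i : s => KaehlerDifferential.D K L i) := by
  obtain ⟨t, hst, ht⟩ := exists_isTranscendenceBasis_superset hx
  exact (linIndep_D_of_basis _ ht).comp (Set.inclusion hst) (Set.inclusion_injective hst)

end DAE
end kaehler



namespace DAE

open MvPolynomial

section diffpoly

variable {K : Type} [Field K] {n : ℕ}

variable {δ : K → K} {D : DP K n → DP K n}

lemma D_zero (hD : IsTotalDeriv K n δ D) : D 0 = 0 := by
  have := hD.map_add 0 0
  simpa using this

lemma pderiv_D (hD : IsTotalDeriv K n δ D) (j : Fin n) (l : ℕ) (g : DP K n) :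
    pderiv (j, l) (D g) = D (pderiv (j, l) g) +
      (if l = 0 then 0 else pderiv (j, l - 1) g) := by
  classical
  induction g using MvPolynomial.induction_on with
  | C a => simp [hD.map_C, D_zero hD]
  | add p q hp hq =>
    rw [hD.map_add, map_add, hp, hq, map_add, hD.map_add]
    split_ifs
    · ring
    · rw [map_add]; ring
  | mul_X p v hp =>
    obtain ⟨j', l'⟩ := v
    have hD1 : D 1 = 0 := by
      have := hD.leibniz 1 1
      simpa using this
    have hc : ∀ a b : Fin n × ℕ, D ((Pi.single a 1 : Fin n × ℕ → DP K n) b) = 0 := by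
      intro a b
      by_cases h : b = a
      · subst h; simp [hD1]
      · simp [Pi.single_eq_of_ne h, D_zero hD]
    rw [hD.leibniz, hD.map_X, map_add, Derivation.leibniz, Derivation.leibniz, hp,
      Derivation.leibniz, hD.map_add, smul_eq_mul, smul_eq_mul, smul_eq_mul, smul_eq_mul,
      smul_eq_mul, smul_eq_mul, hD.leibniz, hD.leibniz, hD.map_X, pderiv_X, pderiv_X, hc]
    cases l with
    | zero => simp [Pi.single_apply]; ring
    | succ l =>
      simp only [Nat.add_one_sub_one, Derivation.leibniz, pderiv_X, Nat.succ_ne_zero, if_false,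
        smul_eq_mul, Pi.single_apply, Prod.mk.injEq, Nat.succ_inj]
      ring

lemma pderiv_iter_eq_zero (hD : IsTotalDeriv K n δ D) (g : DP K n) (j : Fin n) (p : ℕ) :
    ∀ l, ordIn g j + p < l → pderiv (j, l) (D^[p] g) = 0 := by
  induction p with
  | zero =>
    intro l hl
    apply pderiv_eq_zero_of_notMem_vars
    intro h
    have : l ≤ ordIn g j := by
      unfold ordIn
      exact Finset.le_sup (f := fun v : Fin n × ℕ => v.2) (b := (j, l)) (by simpa using h)
    omega
  | succ p ih =>
    intro l hl
    rw [Function.iterate_succ_apply', pderiv_D hD, ih l (by omega), ih (l - 1) (by omega),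
      D_zero hD]
    simp

lemma iter_mem {𝔓 : Ideal (DP K n)} (h : IsDiffIdeal D 𝔓) {g : DP K n} (hg : g ∈ 𝔓) (p : ℕ) :
    D^[p] g ∈ 𝔓 := by
  induction p with
  | zero => exact hg
  | succ p ih => rw [Function.iterate_succ_apply']; exact h _ ih

/-- derivatives outside the first `e` orders stay in `𝔓` -/
lemma pderiv_iter_mem (hD : IsTotalDeriv K n δ D) {𝔓 : Ideal (DP K n)} (h : IsDiffIdeal D 𝔓)
    (e : ℕ) (g : DP K n) (hg : ∀ j l, e ≤ l → pderiv (j, l) g ∈ 𝔓) (q : ℕ) :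
    ∀ j l, e + q ≤ l → pderiv (j, l) (D^[q] g) ∈ 𝔓 := by
  induction q with
  | zero => exact hg
  | succ q ih =>
    intro j l hl
    rw [Function.iterate_succ_apply', pderiv_D hD]
    refine 𝔓.add_mem (h _ (ih j l (by omega))) ?_
    split_ifs
    · exact 𝔓.zero_mem
    · exact ih j (l - 1) (by omega)

/-- the element `∑ W_{(i,p)} f_i^{(p)}` -/
def comb (D : DP K n → DP K n) {r : ℕ} (f : Fin r → DP K n) (W : Fin r × ℕ →₀ DP K n) : DP K n :=
  W.sum fun x c => c * D^[x.2] (f x.1)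

lemma D_comb (hD : IsTotalDeriv K n δ D) {r : ℕ} (f : Fin r → DP K n) (W : Fin r × ℕ →₀ DP K n) :
    D (comb D f W) = comb D f (W.mapRange D (D_zero hD) +
      W.mapDomain (fun x => (x.1, x.2 + 1))) := by
  let DA : DP K n →+ DP K n := ⟨⟨D, D_zero hD⟩, hD.map_add⟩
  have h1 : D (comb D f W) = W.sum fun x c => D (c * D^[x.2] (f x.1)) := by
    unfold comb
    exact map_finsuppSum DA W _
  rw [h1]
  unfold comb
  rw [Finsupp.sum_add_index' (by simp) (by intros; ring),
    Finsupp.sum_mapRange_index (by simp), Finsupp.sum_mapDomain_index (by simp)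
    (by intros; ring), ← Finsupp.sum_add]
  refine Finsupp.sum_congr fun x _ => ?_
  rw [hD.leibniz, Function.iterate_succ_apply']
  ring

lemma exists_comb_iter (hD : IsTotalDeriv K n δ D) {r : ℕ} (f : Fin r → DP K n)
    (W : Fin r × ℕ →₀ DP K n) (t : Fin r) (d : ℕ) (hW : ∀ p, d < p → W (t, p) = 0) (q : ℕ) :
    ∃ W' : Fin r × ℕ →₀ DP K n, D^[q] (comb D f W) = comb D f W' ∧
      W' (t, d + q) = W (t, d) ∧ ∀ p, d + q < p → W' (t, p) = 0 := by
  induction q with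
  | zero => exact ⟨W, rfl, rfl, hW⟩
  | succ q ih =>
    obtain ⟨W', h1, h2, h3⟩ := ih
    have hinj : Function.Injective (fun x : Fin r × ℕ => (x.1, x.2 + 1)) := by
      rintro ⟨a, b⟩ ⟨c, d⟩ h; simpa using h
    have key : ∀ p, (W'.mapRange D (D_zero hD) +
      W'.mapDomain (fun x : Fin r × ℕ => (x.1, x.2 + 1))) (t, p + 1) = D (W' (t, p + 1)) + W' (t, p) := by
      intro p
      rw [Finsupp.add_apply, Finsupp.mapRange_apply]
      congr 1
      exact Finsupp.mapDomain_apply hinj W' (t, p)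
    refine ⟨_, by rw [Function.iterate_succ_apply', h1, D_comb hD], ?_, ?_⟩
    · rw [← add_assoc, key, h3 _ (by omega), D_zero hD, h2, zero_add]
    · intro p hp
      obtain ⟨p, rfl⟩ : ∃ p', p = p' + 1 := ⟨p - 1, by omega⟩
      rw [key, h3 _ (by omega), h3 _ (by omega), D_zero hD, zero_add]

end diffpoly

section grad

variable {K : Type} [Field K] {n : ℕ}

/-- gradient of `g` with entries in `𝕂` -/
def grad (𝔓 : Ideal (DP K n)) [𝔓.IsPrime] (g : DP K n) : Fin n × ℕ → KK K n 𝔓 :=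
  fun v => toKK 𝔓 (pderiv v g)

lemma toKK_eq_zero (𝔓 : Ideal (DP K n)) [𝔓.IsPrime] (g : DP K n) : toKK 𝔓 g = 0 ↔ g ∈ 𝔓 := by
  unfold toKK
  rw [RingHom.comp_apply, ← Ideal.Quotient.eq_zero_iff_mem]
  exact (IsFractionRing.to_map_eq_zero_iff)

lemma grad_comb (𝔓 : Ideal (DP K n)) [𝔓.IsPrime] (D : DP K n → DP K n) {r : ℕ}
    (f : Fin r → DP K n) (hf : ∀ i p, D^[p] (f i) ∈ 𝔓) (W : Fin r × ℕ →₀ DP K n) :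
    grad 𝔓 (comb D f W) = Finsupp.linearCombination (KK K n 𝔓)
      (fun x : Fin r × ℕ => grad 𝔓 (D^[x.2] (f x.1)))
      (W.mapRange (toKK 𝔓) (map_zero _)) := by
  funext v
  rw [Finsupp.linearCombination_apply, Finsupp.sum_mapRange_index (by simp)]
  unfold grad comb
  rw [Finsupp.sum, Finsupp.sum, map_sum, map_sum, Finset.sum_apply]
  refine Finset.sum_congr rfl fun x _ => ?_
  rw [Derivation.leibniz, map_add, smul_eq_mul, smul_eq_mul, map_mul, map_mul,
    (toKK_eq_zero 𝔓 _).2 (hf x.1 x.2)]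
  simp

lemma comb_mem (𝔓 : Ideal (DP K n)) (D : DP K n → DP K n) {r : ℕ}
    (f : Fin r → DP K n) (hf : ∀ i p, D^[p] (f i) ∈ 𝔓) (W : Fin r × ℕ →₀ DP K n) :
    comb D f W ∈ 𝔓 :=
  Ideal.sum_mem _ fun _ _ => 𝔓.mul_mem_left _ (hf _ _)

lemma grad_linearIndependent (𝔓 : Ideal (DP K n)) [𝔓.IsPrime] (D : DP K n → DP K n) {r : ℕ}
    (f : Fin r → DP K n) (e : ℕ) (hqr : IsQuasiRegularAt D f 𝔓 e) :
    LinearIndependent (KK K n 𝔓) (fun x : Fin r × ℕ => grad 𝔓 (D^[x.2] (f x.1))) := by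
  classical
  rw [linearIndependent_iff']
  intro s g hg x hx
  set B := s.sup (fun x => x.2) + 1 with hB
  have hlt : ∀ y ∈ s, y.2 < B := fun y hy => by
    have := Finset.le_sup (f := fun x : Fin r × ℕ => x.2) hy
    omega
  have hrank := hqr B (by omega)
  have hli : LinearIndependent (KK K n 𝔓) (qrJac D f 𝔓 e B).row := by
    rw [linearIndependent_iff_card_eq_finrank_span, Set.finrank, ← Matrix.rank_eq_finrank_span_row,
      hrank]
    simp
  rw [Fintype.linearIndependent_iff] at hli
  have := hli (fun y => if (y.1, (y.2 : ℕ)) ∈ s then g (y.1, (y.2 : ℕ)) else 0) ?_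
    (x.1, ⟨x.2, hlt x hx⟩)
  · simpa [hx] using this
  · funext v
    have h := congrFun hg (v.1, (v.2 : ℕ))
    simp only [Finset.sum_apply, Pi.smul_apply, smul_eq_mul, Pi.zero_apply] at h ⊢
    refine Eq.trans ?_ h
    let em : Fin r × Fin B ↪ Fin r × ℕ := ⟨fun y => (y.1, (y.2 : ℕ)), by
      rintro ⟨a, b⟩ ⟨c, d⟩ h; simpa [Fin.ext_iff] using h⟩
    have hs : s ⊆ Finset.univ.map em := fun y hy => by
      simp only [Finset.mem_map, Finset.mem_univ, true_and]
      exact ⟨(y.1, ⟨y.2, hlt y hy⟩), rfl⟩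
    have hsum : ∑ y ∈ s, g y * grad 𝔓 (D^[y.2] (f y.1)) (v.1, (v.2 : ℕ)) =
        ∑ y ∈ Finset.univ.map em, if y ∈ s then
          g y * grad 𝔓 (D^[y.2] (f y.1)) (v.1, (v.2 : ℕ)) else 0 := by
      rw [Finset.sum_ite_mem, Finset.inter_eq_right.2 hs]
    rw [hsum, Finset.sum_map]
    refine Finset.sum_congr rfl fun y _ => ?_
    rw [ite_mul, zero_mul]
    rfl

lemma indep_aux {F : Type} [Field F] {r s : ℕ} (cut : Fin r → ℕ) (t : Fin r)
    (z : Fin s → (Fin r × ℕ →₀ F)) (dg : Fin s → ℕ) (hdg : StrictMono dg)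
    (hcut : ∀ q, cut t ≤ dg q) (hne : ∀ q, z q (t, dg q) ≠ 0)
    (hz : ∀ q p, dg q < p → z q (t, p) = 0) :
    LinearIndependent F (Sum.elim
      (fun x : Σ i, Fin (cut i) => Finsupp.single ((x.1, (x.2 : ℕ)) : Fin r × ℕ) (1 : F)) z) := by
  classical
  rw [Fintype.linearIndependent_iff]
  intro c hc
  rw [Fintype.sum_sum_type] at hc
  simp only [Sum.elim_inl, Sum.elim_inr] at hc
  have hr : ∀ q, c (Sum.inr q) = 0 := by
    by_contra hcon
    push Not at hcon
    obtain ⟨q0, hq0⟩ := hcon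
    obtain ⟨q, hq, hmax⟩ := (Finset.univ.filter fun q => c (Sum.inr q) ≠ 0).exists_max_image id
      ⟨q0, by simpa using hq0⟩
    simp only [Finset.mem_filter, Finset.mem_univ, true_and, id] at hq hmax
    have h := DFunLike.congr_fun hc (t, dg q)
    rw [Finsupp.add_apply, Finsupp.finsetSum_apply, Finsupp.finsetSum_apply,
      Finset.sum_eq_zero, zero_add, Finset.sum_eq_single q] at h
    · simp [hq, hne] at h
    · intro q' _ hq'
      by_cases h0 : c (Sum.inr q') = 0
      · simp [h0]
      · have : q' < q := lt_of_le_of_ne (hmax q' h0) hq'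
        simp [hz q' _ (hdg this)]
    · simp
    · rintro ⟨i, p⟩ _
      rw [Finsupp.smul_apply, Finsupp.single_apply, if_neg, smul_zero]
      intro h
      rw [Prod.mk.injEq] at h
      obtain ⟨h1, h2⟩ := h
      subst h1
      have := p.2
      have := hcut q
      omega
  rintro (⟨i, p⟩ | q)
  · have h := DFunLike.congr_fun hc (i, (p : ℕ))
    simp only [hr, zero_smul, Finset.sum_const_zero, add_zero] at h
    rw [Finsupp.finsetSum_apply, Finset.sum_eq_single ⟨i, p⟩] at h
    · simpa using h
    · rintro ⟨i', p'⟩ _ hne'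
      rw [Finsupp.smul_apply, Finsupp.single_apply, if_neg, smul_zero]
      intro h
      rw [Prod.mk.injEq] at h
      obtain ⟨h1, h2⟩ := h
      dsimp only at h1 h2
      subst h1
      exact hne' (by rw [Fin.ext h2])
    · simp
  · exact hr q

end grad

end DAE


namespace DAE

open MvPolynomial

section leftker

variable {K : Type} [Field K] {n : ℕ}

lemma finrank_leftker {F m n' : Type} [Field F] [Fintype m] [Fintype n'] [DecidableEq m]
    (M : Matrix m n' F) :
    M.rank + Module.finrank F (LinearMap.ker M.transpose.mulVecLin) = Fintype.card m := by
  rw [← Matrix.rank_transpose, Matrix.rank, LinearMap.finrank_range_add_finrank_ker]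
  simp

lemma exists_leftker (D : DP K n → DP K n) {r : ℕ} (f : Fin r → DP K n)
    (𝔓 : Ideal (DP K n)) [𝔓.IsPrime] (e k : ℕ)
    (h : mu D f 𝔓 e k (e - 1) < mu D f 𝔓 e (k + 1) (e - 1)) :
    ∃ u : Fin (k + 1) × Fin r → KK K n 𝔓,
      (∀ q, ∑ p, Jmat D f 𝔓 e (k + 1) (e - 1) p q * u p = 0) ∧ ∃ t, u (Fin.last k, t) ≠ 0 := by
  by_contra hcon
  push Not at hcon
  set M := Jmat D f 𝔓 e (k + 1) (e - 1) with hM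
  set M' := Jmat D f 𝔓 e k (e - 1) with hM'
  have h1 := finrank_leftker M
  have h2 := finrank_leftker M'
  have hk : ∀ u ∈ LinearMap.ker M.transpose.mulVecLin, ∀ q, ∑ p, M p q * u p = 0 := by
    intro u hu q
    have := congrFun (LinearMap.mem_ker.1 hu) q
    exact this
  let res : (Fin (k + 1) × Fin r → KK K n 𝔓) →ₗ[KK K n 𝔓] (Fin k × Fin r → KK K n 𝔓) :=
    LinearMap.funLeft _ _ (fun x => (x.1.castSucc, x.2))
  have hmap : ∀ u ∈ LinearMap.ker M.transpose.mulVecLin,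
      res u ∈ LinearMap.ker M'.transpose.mulVecLin := by
    intro u hu
    rw [LinearMap.mem_ker]
    funext q
    have := hk u hu (q.1.castSucc, q.2)
    rw [Fintype.sum_prod_type, Fin.sum_univ_castSucc] at this
    simp only [hcon u (hk u hu), mul_zero, Finset.sum_const_zero, add_zero] at this
    simp only [Matrix.mulVecLin_apply, Matrix.mulVec, dotProduct, Matrix.transpose_apply,
      Pi.zero_apply, Fintype.sum_prod_type]
    rw [← this]
    rfl
  have hle := LinearMap.finrank_le_finrank_of_injective (f := res.restrict hmap) (by
    rw [← LinearMap.ker_eq_bot, LinearMap.ker_eq_bot']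
    rintro ⟨u, hu⟩ h0
    have h0' : res u = 0 := congrArg Subtype.val h0
    ext ⟨p, t⟩
    refine Fin.lastCases ?_ (fun p => ?_) p
    · exact hcon u (hk u hu) t
    · exact congrFun h0' (p, t))
  unfold mu at h
  rw [← hM, ← hM'] at h
  simp only [Fintype.card_prod, Fintype.card_fin] at h1 h2
  omega

lemma exists_top_comb {δ : K → K} (D : DP K n → DP K n) (hD : IsTotalDeriv K n δ D) {r : ℕ}
    (f : Fin r → DP K n)
    (𝔓 : Ideal (DP K n)) [𝔓.IsPrime] (hf : ∀ i p, D^[p] (f i) ∈ 𝔓)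
    (e k : ℕ) (he1 : 1 ≤ e) (he : ∀ i j, ordIn (f i) j ≤ e)
    (h : mu D f 𝔓 e k (e - 1) < mu D f 𝔓 e (k + 1) (e - 1)) :
    ∃ (W : Fin r × ℕ →₀ DP K n) (t : Fin r), W (t, k) ∉ 𝔓 ∧ (∀ p, k < p → W (t, p) = 0) ∧
      ∀ j l, e ≤ l → pderiv (j, l) (comb D f W) ∈ 𝔓 := by
  classical
  obtain ⟨u, hu, t, ht⟩ := exists_leftker D f 𝔓 e k h
  obtain ⟨d, hd⟩ := IsLocalization.exist_integer_multiples_of_finite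
    (nonZeroDivisors (DP K n ⧸ 𝔓)) u
  choose g hg using hd
  choose w hw using fun x => Ideal.Quotient.mk_surjective (g x)
  have hw' : ∀ x, toKK 𝔓 (w x) = algebraMap _ (KK K n 𝔓) (d : DP K n ⧸ 𝔓) * u x := by
    intro x
    unfold toKK
    rw [RingHom.comp_apply, hw, hg, Algebra.smul_def]
  have hd0 : algebraMap _ (KK K n 𝔓) (d : DP K n ⧸ 𝔓) ≠ 0 :=
    IsFractionRing.to_map_ne_zero_of_mem_nonZeroDivisors d.2
  let em : Fin (k + 1) × Fin r ↪ Fin r × ℕ := ⟨fun y => (y.2, (y.1 : ℕ)), by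
      rintro ⟨a, b⟩ ⟨c, d⟩ h; simp [Fin.ext_iff] at h ⊢; tauto⟩
  let W : Fin r × ℕ →₀ DP K n := (Finsupp.equivFunOnFinite.symm w).embDomain em
  have hsum : ∀ (F : Fin r × ℕ → DP K n → DP K n), (∀ x, F x 0 = 0) →
      W.sum F = ∑ y, F (em y) (w y) := by
    intro F hF
    rw [Finsupp.sum_embDomain, Finsupp.sum_fintype _ _ (fun _ => hF _)]
    rfl
  refine ⟨W, t, ?_, ?_, ?_⟩
  · have : W (t, k) = w (Fin.last k, t) :=
      Finsupp.embDomain_apply_self em (Finsupp.equivFunOnFinite.symm w) (Fin.last k, t)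
    rw [this, ← toKK_eq_zero, hw']
    exact mul_ne_zero hd0 ht
  · intro p hp
    apply Finsupp.embDomain_of_notMem_range
    rintro ⟨y, hy⟩
    have : (y.1 : ℕ) = p := congrArg Prod.snd hy
    have := y.1.2
    omega
  · intro j l hl
    rw [← toKK_eq_zero]
    unfold comb
    rw [hsum _ (by simp), map_sum, map_sum]
    have hterm : ∀ y, toKK 𝔓 (pderiv (j, l) (w y * D^[(em y).2] (f (em y).1))) =
        algebraMap _ (KK K n 𝔓) (d : DP K n ⧸ 𝔓) *
          (toKK 𝔓 (pderiv (j, l) (D^[(y.1 : ℕ)] (f y.2))) * u y) := by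
      intro y
      rw [Derivation.leibniz, map_add, smul_eq_mul, smul_eq_mul, map_mul, map_mul,
        (toKK_eq_zero 𝔓 _).2 (hf (em y).1 (em y).2), hw']
      simp only [zero_mul, add_zero]
      change _ * toKK 𝔓 (pderiv (j, l) (D^[(y.1 : ℕ)] (f y.2))) = _
      ring
    simp only [hterm, ← Finset.mul_sum]
    by_cases hl2 : l < e + (k + 1)
    · have := hu (⟨l - e, by omega⟩, j)
      unfold Jmat jEntry at this
      simp only [show e - 1 + 1 - e = 0 by omega, zero_add,
        show e - 1 + 1 + (l - e) = l by omega] at this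
      rw [this, mul_zero]
    · rw [Finset.sum_eq_zero, mul_zero]
      intro y _
      rw [pderiv_iter_eq_zero hD, map_zero, zero_mul]
      have := he y.2 j
      have := y.1.2
      omega

end leftker

end DAE


namespace DAE

open MvPolynomial

section counting

variable {K : Type} [Field K] {n : ℕ}

/-- `toKK` as an algebra map -/
def toKKa (𝔓 : Ideal (DP K n)) [𝔓.IsPrime] : DP K n →ₐ[K] KK K n 𝔓 :=
  (IsScalarTower.toAlgHom K (DP K n ⧸ 𝔓) (KK K n 𝔓)).comp (Ideal.Quotient.mkₐ K 𝔓)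

lemma toKKa_apply (𝔓 : Ideal (DP K n)) [𝔓.IsPrime] (g : DP K n) : toKKa 𝔓 g = toKK 𝔓 g := rfl

/-- the differentials of the coordinates -/
def dx (𝔓 : Ideal (DP K n)) [𝔓.IsPrime] (v : Fin n × ℕ) : Ω[KK K n 𝔓⁄K] :=
  KaehlerDifferential.D K (KK K n 𝔓) (toKKa 𝔓 (X v))

lemma d_toKK (𝔓 : Ideal (DP K n)) [𝔓.IsPrime] (g : DP K n) :
    ∃ T0 : Finset (Fin n × ℕ), ∀ T, T0 ⊆ T →
      KaehlerDifferential.D K (KK K n 𝔓) (toKKa 𝔓 g) = ∑ v ∈ T, grad 𝔓 g v • dx 𝔓 v := by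
  classical
  induction g using MvPolynomial.induction_on with
  | C a =>
    refine ⟨∅, fun T _ => ?_⟩
    have : toKKa 𝔓 (C a) = algebraMap K _ a := AlgHom.commutes (toKKa 𝔓) a
    rw [this, Derivation.map_algebraMap]
    simp [grad]
  | add p q hp hq =>
    obtain ⟨T1, h1⟩ := hp
    obtain ⟨T2, h2⟩ := hq
    refine ⟨T1 ∪ T2, fun T hT => ?_⟩
    rw [map_add, map_add, h1 T (Finset.union_subset_left hT), h2 T (Finset.union_subset_right hT),
      ← Finset.sum_add_distrib]
    refine Finset.sum_congr rfl fun v _ => ?_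
    rw [← add_smul]
    simp [grad]
  | mul_X p w hp =>
    obtain ⟨T1, h1⟩ := hp
    refine ⟨insert w T1, fun T hT => ?_⟩
    have hw : w ∈ T := hT (Finset.mem_insert_self _ _)
    rw [map_mul, Derivation.leibniz, h1 T ((Finset.subset_insert _ _).trans hT)]
    have hg : ∀ v, grad 𝔓 (p * X w) v = (if v = w then toKKa 𝔓 p else 0) +
        toKKa 𝔓 (X w) * grad 𝔓 p v := by
      intro v
      unfold grad
      rw [Derivation.leibniz, map_add, smul_eq_mul, smul_eq_mul, map_mul, map_mul, pderiv_X,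
        Pi.single_apply]
      by_cases h : v = w
      · subst h; simp [toKKa_apply]
      · have h' : w ≠ v := fun h' => h h'.symm
        simp [toKKa_apply, h, h']
    simp only [hg, add_smul, Finset.sum_add_distrib, mul_smul, ← Finset.smul_sum, ite_smul,
      zero_smul, Finset.sum_ite_eq', hw, if_true]
    rfl

lemma linIndep_D' {K L ι : Type} [Field K] [Field L] [Algebra K L] [CharZero K]
    (x : ι → L) (hx : AlgebraicIndependent K x) :
    LinearIndependent L (fun i => KaehlerDifferential.D K L (x i)) :=
  (linIndep_D (Set.range x) hx.coe_range).comp (fun i => ⟨x i, i, rfl⟩) (fun i j h => by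
    exact hx.injective (congrArg Subtype.val h))

lemma count_le [CharZero K] (𝔓 : Ideal (DP K n)) [𝔓.IsPrime] (N d : ℕ)
    (hT : HasTrdeg K (FractionRing (AP K n N ⧸ Pc N 𝔓)) d)
    (S : Finset (Fin n × ℕ)) (hS : ∀ j l, l ≤ N → (j, l) ∈ S)
    {ι : Type} [Fintype ι] (g : ι → DP K n) (hg : ∀ i, g i ∈ 𝔓)
    (hgS : ∀ i, ∀ v ∉ S, grad 𝔓 (g i) v = 0)
    (hli : LinearIndependent (KK K n 𝔓) (fun i => grad 𝔓 (g i))) :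
    Fintype.card ι + d ≤ S.card := by
  classical
  obtain ⟨s, hs, rfl⟩ := hT
  let φ : (S → KK K n 𝔓) →ₗ[KK K n 𝔓] Ω[KK K n 𝔓⁄K] :=
    Fintype.linearCombination (KK K n 𝔓) (fun w : S => dx 𝔓 w)
  have hφ : ∀ z, φ z = ∑ w : S, z w • dx 𝔓 w := fun z => Fintype.linearCombination_apply _ _ _
  -- kernel
  have h1 : ∀ i, φ (fun w : S => grad 𝔓 (g i) w) = 0 := by
    intro i
    obtain ⟨T0, h0⟩ := d_toKK 𝔓 (g i)
    have h := h0 (T0 ∪ S) Finset.subset_union_left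
    rw [toKKa_apply, (toKK_eq_zero 𝔓 _).2 (hg i), map_zero,
      ← Finset.sum_subset (Finset.subset_union_right (s₁ := T0) (s₂ := S))
        (fun v _ hv => by rw [hgS i v hv, zero_smul])] at h
    rw [hφ, h]
    exact Finset.sum_coe_sort S (fun v => grad 𝔓 (g i) v • dx 𝔓 v)
  have h2 : LinearIndependent (KK K n 𝔓) (fun i => (fun w : S => grad 𝔓 (g i) w)) := by
    rw [Fintype.linearIndependent_iff] at hli ⊢
    intro c hc
    apply hli c
    funext v
    by_cases hv : v ∈ S
    · have := congrFun hc ⟨v, hv⟩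
      simpa using this
    · simp [hgS _ v hv]
  have h3 : Fintype.card ι ≤ Module.finrank (KK K n 𝔓) (LinearMap.ker φ) := by
    have : LinearIndependent (KK K n 𝔓) (fun i => (⟨_, h1 i⟩ : LinearMap.ker φ)) :=
      LinearIndependent.of_comp (LinearMap.ker φ).subtype h2
    exact this.fintype_card_le_finrank
  -- range
  let R := LinearMap.range φ
  have hdx : ∀ v ∈ S, dx 𝔓 v ∈ R := by
    intro v hv
    refine ⟨Pi.single ⟨v, hv⟩ 1, ?_⟩
    rw [hφ, Finset.sum_eq_single ⟨v, hv⟩]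
    · simp
    · intro w _ hw; simp [hw]
    · simp
  let ψ0 : AP K n N →ₐ[K] KK K n 𝔓 := (toKKa 𝔓).comp
    (rename fun v : Fin n × Fin (N + 1) => ((v.1, (v.2 : ℕ)) : Fin n × ℕ))
  have hψ0 : ∀ a, ψ0 a = 0 ↔ a ∈ Pc N 𝔓 := fun a => toKK_eq_zero 𝔓 _
  let ψ1 : (AP K n N ⧸ Pc N 𝔓) →ₐ[K] KK K n 𝔓 :=
    Ideal.Quotient.liftₐ _ ψ0 (fun a ha => (hψ0 a).2 ha)
  have hψ1 : Function.Injective ψ1 := by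
    rw [injective_iff_map_eq_zero]
    intro a ha
    obtain ⟨a, rfl⟩ := Ideal.Quotient.mk_surjective a
    rw [Ideal.Quotient.eq_zero_iff_mem, ← hψ0]
    exact ha
  let ψ : FractionRing (AP K n N ⧸ Pc N 𝔓) →ₐ[K] KK K n 𝔓 := IsFractionRing.liftAlgHom hψ1
  have hψ : Function.Injective ψ := ψ.toRingHom.injective
  have hA : ∀ a : AP K n N, KaehlerDifferential.D K (KK K n 𝔓) (ψ0 a) ∈ R := by
    intro a
    induction a using MvPolynomial.induction_on with
    | C a =>
      have : ψ0 (C a) = algebraMap K _ a := AlgHom.commutes ψ0 a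
      rw [this, Derivation.map_algebraMap]
      exact R.zero_mem
    | add p q hp hq => rw [map_add, map_add]; exact R.add_mem hp hq
    | mul_X p w hp =>
      rw [map_mul, Derivation.leibniz]
      refine R.add_mem (R.smul_mem _ ?_) (R.smul_mem _ hp)
      have : ψ0 (X w) = toKKa 𝔓 (X (w.1, (w.2 : ℕ))) := by
        simp [ψ0]
      rw [this]
      exact hdx _ (hS _ _ (by have := w.2.2; omega))
  have hL : ∀ z, KaehlerDifferential.D K (KK K n 𝔓) (ψ z) ∈ R := by
    intro z
    obtain ⟨a, b, hb, rfl⟩ := IsFractionRing.div_surjective (A := AP K n N ⧸ Pc N 𝔓) z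
    obtain ⟨a, rfl⟩ := Ideal.Quotient.mk_surjective a
    obtain ⟨b, rfl⟩ := Ideal.Quotient.mk_surjective b
    have hq : ∀ c : AP K n N, ψ (algebraMap _ _ (Ideal.Quotient.mk (Pc N 𝔓) c)) = ψ0 c := by
      intro c
      exact IsFractionRing.lift_algebraMap hψ1 _
    rw [map_div₀, hq, hq, Derivation.leibniz_div]
    exact R.smul_mem _ (R.sub_mem (R.smul_mem _ (hA _)) (R.smul_mem _ (hA _)))
  have h4 : s.card ≤ Module.finrank (KK K n 𝔓) R := by
    have hai : AlgebraicIndependent K (fun x : {x // x ∈ s} => ψ x.1) :=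
      hs.1.map' hψ
    have hli3 : LinearIndependent (KK K n 𝔓)
        (fun x : {x // x ∈ s} => KaehlerDifferential.D K (KK K n 𝔓) (ψ x.1)) :=
      linIndep_D' _ hai
    have : LinearIndependent (KK K n 𝔓)
        (fun x : {x // x ∈ s} => (⟨_, hL x.1⟩ : R)) :=
      LinearIndependent.of_comp R.subtype hli3
    simpa using this.fintype_card_le_finrank
  have h5 := LinearMap.finrank_range_add_finrank_ker φ
  rw [Module.finrank_fintype_fun_eq_card, Fintype.card_coe] at h5
  have h6 : Module.finrank (KK K n 𝔓) R = Module.finrank (KK K n 𝔓) (LinearMap.range φ) := rfl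
  omega

end counting

end DAE

namespace DAE

open MvPolynomial

/-- The `𝔓`-differentiation index `σ` and the order `ord(𝔓)`
(encoded by the Hilbert–Kolchin constant `c`) satisfy
`σ + ord(𝔓) ≤ J(𝓔₀) + max ε_{tj} − min ε_{tj}`, where `𝓔₀` is the `r×n` matrix of
the orders `ε_{tj} = ord_{X_j}(f_t)` (with `0` for absent variables) and
`e = max ε_{tj}`. -/
theorem index_plus_order_le_jacobi
    {K : Type} [Field K] [CharZero K] {n r : ℕ} (hrn : r ≤ n)
    (δ : K → K) (hδ : IsDeriv K δ)
    (D : DP K n → DP K n) (hD : IsTotalDeriv K n δ D)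
    (f : Fin r → DP K n)
    (e : ℕ) (he : e = Finset.univ.sup fun p : Fin r × Fin n => ordIn (f p.1) p.2)
    (he1 : 1 ≤ e)
    (𝔓 : Ideal (DP K n)) [𝔓.IsPrime]
    (hmin : IsMinimalPrimeDiff D f 𝔓)
    (hqr : IsQuasiRegularAt D f 𝔓 e)
    (hsr : StandingRank D f 𝔓 e)
    (σ : ℕ)
    (hσ : ∀ k : ℕ,
      (k < σ → mu D f 𝔓 e k (e - 1) < mu D f 𝔓 e (k + 1) (e - 1)) ∧
      (σ ≤ k → mu D f 𝔓 e k (e - 1) = mu D f 𝔓 e (k + 1) (e - 1)))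
    (c : ℕ)
    (hord : ∃ i₀ : ℕ, ∀ i : ℕ, i₀ ≤ i →
      HasTrdeg K (FractionRing (AP K n i ⧸ Pc i 𝔓)) ((n - r) * (i + 1) + c)) :
    (σ : ℤ) + c ≤ (jacobiN (fun t j => ordIn (f t) j) : ℤ) + e -
      sInf (Set.range fun p : Fin r × Fin n => ordIn (f p.1) p.2) := by
  classical
  obtain ⟨hprime, hdiff, hfP, -⟩ := hmin
  have hf : ∀ i p, D^[p] (f i) ∈ 𝔓 := fun i p => iter_mem hdiff (hfP i) p
  have hle : ∀ i j, ordIn (f i) j ≤ e := fun i j => by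
    rw [he]
    exact Finset.le_sup (f := fun p : Fin r × Fin n => ordIn (f p.1) p.2) (Finset.mem_univ (i, j))
  have hne : Nonempty (Fin r × Fin n) := by
    by_contra hcon
    rw [not_nonempty_iff] at hcon
    rw [Finset.univ_eq_empty, Finset.sup_empty] at he
    simp at he
    omega
  obtain ⟨t0, j0⟩ := hne
  set m := sInf (Set.range fun p : Fin r × Fin n => ordIn (f p.1) p.2) with hm
  have hml : ∀ i j, m ≤ ordIn (f i) j := fun i j => Nat.sInf_le ⟨(i, j), rfl⟩
  have hme : m ≤ e := (hml t0 j0).trans (hle t0 j0)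
  obtain ⟨a, b, τ, hτ, ham, hab, hsum⟩ := egervary hrn (Fin.pos j0) (fun i j => ordIn (f i) j) m hml
  have hJ : ∑ i, a i + ∑ j, b j ≤ jacobiN (fun t j => ordIn (f t) j) :=
    hsum.trans (Finset.le_sup (f := fun τ : {τ : Fin r → Fin n // Function.Injective τ} =>
      ∑ i, ordIn (f i) (τ.1 i)) (Finset.mem_univ ⟨τ, hτ⟩))
  obtain ⟨i₀, hord⟩ := hord
  obtain ⟨s, hs⟩ : ∃ s, s = σ + m - e := ⟨_, rfl⟩
  obtain ⟨M, hM⟩ : ∃ M, M = i₀ + ∑ i, a i + s := ⟨_, rfl⟩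
  obtain ⟨N, hN⟩ : ∃ N, N = e - 1 + M := ⟨_, rfl⟩
  have haN : ∀ i, a i ≤ N := fun i => by
    have := Finset.single_le_sum (f := a) (fun _ _ => Nat.zero_le _) (Finset.mem_univ i)
    omega
  -- the extra elements
  have hextra : ∃ W : Fin s → (Fin r × ℕ →₀ DP K n),
      LinearIndependent (KK K n 𝔓) (Sum.elim
        (fun x : Σ i, Fin (N + 1 - a i) =>
          Finsupp.single ((x.1, (x.2 : ℕ)) : Fin r × ℕ) (1 : KK K n 𝔓))
        (fun q => (W q).mapRange (toKK 𝔓) (map_zero _))) ∧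
      ∀ q j l, N < l → grad 𝔓 (comb D f (W q)) (j, l) = 0 := by
    rcases Nat.eq_zero_or_pos s with h0 | hpos
    · clear_value m
      subst h0
      refine ⟨fun q => q.elim0, ?_, fun q => q.elim0⟩
      exact indep_aux (fun i => N + 1 - a i) t0 _ (fun q => q.elim0) (fun q => q.elim0)
        (fun q => q.elim0) (fun q => q.elim0) (fun q => q.elim0)
    · obtain ⟨k, rfl⟩ : ∃ k, σ = k + 1 := ⟨σ - 1, by omega⟩
      obtain ⟨W, t, hW1, hW2, hW3⟩ := exists_top_comb D hD f 𝔓 hf e k he1 hle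
        ((hσ k).1 (by omega))
      choose W' h1 h2 h3 using fun q => exists_comb_iter hD f W t k hW2 q
      refine ⟨fun q => W' (M - s + 1 + q), ?_, ?_⟩
      · apply indep_aux (fun i => N + 1 - a i) t _ (fun q => k + (M - s + 1 + q))
        · intro q q' hq
          have : (q : ℕ) < q' := hq
          try dsimp only
          omega
        · intro q
          have := ham t
          try dsimp only
          omega
        · intro q
          rw [Finsupp.mapRange_apply, h2, Ne, toKK_eq_zero]
          exact hW1
        · intro q p hp
          rw [Finsupp.mapRange_apply, h3 _ _ hp, map_zero]
      · intro q j l hl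
        have hq := q.2
        unfold grad
        rw [toKK_eq_zero, ← h1]
        exact pderiv_iter_mem hD hdiff e _ hW3 _ j l (by omega)
  obtain ⟨W, hWli, hWv⟩ := hextra
  let S : Finset (Fin n × ℕ) := (Finset.univ.sigma fun j => Finset.range (N + b j + 1)).map
    (Equiv.sigmaEquivProd (Fin n) ℕ).toEmbedding
  have hSmem : ∀ j l, (j, l) ∈ S ↔ l ≤ N + b j := by
    intro j l
    simp only [S, Finset.mem_map_equiv, Equiv.sigmaEquivProd_symm_apply, Finset.mem_sigma,
      Finset.mem_univ, true_and, Finset.mem_range]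
    omega
  have hScard : S.card = n * (N + 1) + ∑ j, b j := by
    simp only [S, Finset.card_map, Finset.card_sigma, Finset.card_range]
    have hc : ∑ _j : Fin n, (N + 1) = n * (N + 1) := by simp
    rw [← hc, ← Finset.sum_add_distrib]
    exact Finset.sum_congr rfl fun j _ => by omega
  have hcount := count_le 𝔓 N _ (hord N (by omega)) S
    (fun j l hl => (hSmem j l).2 (by omega))
    (Sum.elim (fun x : Σ i, Fin (N + 1 - a i) => D^[(x.2 : ℕ)] (f x.1))
      (fun q => comb D f (W q))) ?_ ?_ ?_
  · rw [hScard, Fintype.card_sum, Fintype.card_sigma, Fintype.card_fin] at hcount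
    simp only [Fintype.card_fin] at hcount
    have hA : ∑ i, (N + 1 - a i) + ∑ i, a i = r * (N + 1) := by
      rw [← Finset.sum_add_distrib, Finset.sum_congr rfl (g := fun _ => N + 1)
        (fun i _ => by have := haN i; omega)]
      simp
    have hn : n * (N + 1) = (n - r) * (N + 1) + r * (N + 1) := by
      rw [← add_mul, Nat.sub_add_cancel hrn]
    omega
  · rintro (x | q)
    · exact hf _ _
    · exact comb_mem 𝔓 D f hf _
  · rintro (⟨i, p⟩ | q) ⟨j, l⟩ hv
    · rw [hSmem] at hv
      simp only [Sum.elim_inl, grad]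
      rw [pderiv_iter_eq_zero hD, map_zero]
      have := hab i j
      have := haN i
      have := p.2
      try dsimp only
      omega
    · rw [hSmem] at hv
      exact hWv q j l (by omega)
  · have hli := grad_linearIndependent 𝔓 D f e hqr
    have := hWli.map' _ (LinearMap.ker_eq_bot.2 hli)
    have heq : (fun i => grad 𝔓 ((Sum.elim (fun x : Σ i, Fin (N + 1 - a i) => D^[(x.2 : ℕ)] (f x.1))
        (fun q => comb D f (W q))) i)) = (Finsupp.linearCombination (KK K n 𝔓)
          (fun x : Fin r × ℕ => grad 𝔓 (D^[x.2] (f x.1)))) ∘ (Sum.elim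
          (fun x : Σ i, Fin (N + 1 - a i) => Finsupp.single (x.1, (x.2 : ℕ)) (1 : KK K n 𝔓))
          (fun q => (W q).mapRange (toKK 𝔓) (map_zero _))) := by
      funext x
      rcases x with x | q
      · simp
      · simp only [Sum.elim_inr, Function.comp_apply]
        exact grad_comb 𝔓 D f hf _
    rw [heq]
    exact this

end DAE
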